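/- (Construction of self-dual antinorms in the plane, sufficiency.) Let a ∈ ℝ²₊ with |a| = 1, and let K₁ = {x ∈ ℝ²₊ : a₁x₂ − a₂x₁ ≥ 0} and K₂ = {x ∈ ℝ²₊ : a₁x₂ − a₂x₁ ≤ 0} be the two cones into which the ray {ta : t ≥ 0} splits ℝ²₊. Let f₁ be a continuous antinorm on K₁ with f₁(a) = 1 and f₁(x) ≤ ⟨a,x⟩ for all x ∈ K₁. Define f₂ on K₂ by f₂(y) = inf{⟨x,y⟩/f₁(x) : x ∈ K₁, f₁(x) ≠ 0}, and define f on ℝ²₊ by f = f₁ on K₁ and f = f₂ on K₂. Then f is well defined (f₁ and f₂ agree on the ray through a) and is a self-dual antinorm on ℝ²₊. -/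

import Mathlib

open scoped BigOperators

noncomputable section

/-- The positive orthant in Euclidean space `ℝ^d`. -/
def pos (d : ℕ) : Set (EuclideanSpace ℝ (Fin d)) := {x | ∀ i, 0 ≤ x i}

/-- Euclidean inner product of two vectors. -/
def dot {d : ℕ} (p x : EuclideanSpace ℝ (Fin d)) : ℝ := ∑ i, p i * x i

/-- An antinorm on a set `K`: nonnegative, positively homogeneous, concave on `K`
and strictly positive somewhere on `K`. -/
def IsAntinormOn {d : ℕ} (K : Set (EuclideanSpace ℝ (Fin d)))
    (f : EuclideanSpace ℝ (Fin d) → ℝ) : Prop :=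
  (∀ x ∈ K, 0 ≤ f x) ∧
  (∀ x ∈ K, ∀ l : ℝ, 0 ≤ l → f (l • x) = l * f x) ∧
  ConcaveOn ℝ K f ∧
  ∃ x ∈ K, 0 < f x

/-- An antinorm on the positive orthant. -/
def IsAntinorm {d : ℕ} (f : EuclideanSpace ℝ (Fin d) → ℝ) : Prop :=
  IsAntinormOn (pos d) f

/-- The dual antinorm `f*(p) = inf {⟨p,x⟩/f(x) : x ∈ ℝ^d₊, f(x) ≠ 0}`. -/
def dualAntinorm {d : ℕ} (f : EuclideanSpace ℝ (Fin d) → ℝ)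
    (p : EuclideanSpace ℝ (Fin d)) : ℝ :=
  sInf ((fun x => dot p x / f x) '' {x | x ∈ pos d ∧ f x ≠ 0})

/-- The part of `ℝ²₊` on one side of the ray through `a`. -/
def K1 (a : EuclideanSpace ℝ (Fin 2)) : Set (EuclideanSpace ℝ (Fin 2)) :=
  {x ∈ pos 2 | 0 ≤ a 0 * x 1 - a 1 * x 0}

/-- The part of `ℝ²₊` on the other side of the ray through `a`. -/
def K2 (a : EuclideanSpace ℝ (Fin 2)) : Set (EuclideanSpace ℝ (Fin 2)) :=
  {x ∈ pos 2 | a 0 * x 1 - a 1 * x 0 ≤ 0}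

lemma dot_two (p x : EuclideanSpace ℝ (Fin 2)) : dot p x = p 0 * x 0 + p 1 * x 1 := by
  simp [dot, Fin.sum_univ_two]

lemma dot_comm {d : ℕ} (p x : EuclideanSpace ℝ (Fin d)) : dot p x = dot x p := by
  simp [dot, mul_comm]

lemma dot_add {d : ℕ} (p x y : EuclideanSpace ℝ (Fin d)) :
    dot p (x + y) = dot p x + dot p y := by
  simp [dot, mul_add, Finset.sum_add_distrib]

lemma dot_smul {d : ℕ} (p x : EuclideanSpace ℝ (Fin d)) (l : ℝ) :
    dot p (l • x) = l * dot p x := by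
  simp [dot, Finset.mul_sum, mul_left_comm]

lemma dot_nonneg {d : ℕ} {p x : EuclideanSpace ℝ (Fin d)} (hp : p ∈ pos d) (hx : x ∈ pos d) :
    0 ≤ dot p x :=
  Finset.sum_nonneg fun i _ => mul_nonneg (hp i) (hx i)

/-- Every linear functional is the product with some vector. -/
lemma exists_eq_dot {d : ℕ} (l : EuclideanSpace ℝ (Fin d) →L[ℝ] ℝ) :
    ∃ v, ∀ x, l x = dot v x := by
  refine ⟨(InnerProductSpace.toDual ℝ _).symm l, fun x => ?_⟩
  rw [← InnerProductSpace.toDual_symm_apply (𝕜 := ℝ) (x := x) (y := l)]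
  simp only [dot, PiLp.inner_apply, RCLike.inner_apply, conj_trivial, mul_comm]

lemma pos_add {d : ℕ} {x y : EuclideanSpace ℝ (Fin d)} (hx : x ∈ pos d) (hy : y ∈ pos d) :
    x + y ∈ pos d := fun i => add_nonneg (hx i) (hy i)

lemma pos_smul {d : ℕ} {x : EuclideanSpace ℝ (Fin d)} (hx : x ∈ pos d) {l : ℝ} (hl : 0 ≤ l) :
    l • x ∈ pos d := fun i => mul_nonneg hl (hx i)

lemma K1_smul {a x : EuclideanSpace ℝ (Fin 2)} (hx : x ∈ K1 a) {l : ℝ} (hl : 0 ≤ l) :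
    l • x ∈ K1 a := by
  refine ⟨pos_smul hx.1 hl, ?_⟩
  have := mul_nonneg hl hx.2
  simp only [PiLp.smul_apply, smul_eq_mul]
  linarith

lemma K2_smul {a x : EuclideanSpace ℝ (Fin 2)} (hx : x ∈ K2 a) {l : ℝ} (hl : 0 ≤ l) :
    l • x ∈ K2 a := by
  refine ⟨pos_smul hx.1 hl, ?_⟩
  have := mul_nonpos_of_nonneg_of_nonpos hl hx.2
  simp only [PiLp.smul_apply, smul_eq_mul]
  linarith

lemma isClosed_K1 (a : EuclideanSpace ℝ (Fin 2)) : IsClosed (K1 a) := by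
  have h : K1 a = {x | 0 ≤ x 0} ∩ {x | 0 ≤ x 1} ∩ {x | 0 ≤ a 0 * x 1 - a 1 * x 0} := by
    ext x
    simp [K1, pos, Fin.forall_fin_two]
  rw [h]
  refine (IsClosed.inter ?_ ?_).inter ?_ <;> exact isClosed_le (by fun_prop) (by fun_prop)

/-- A lower bound for an infimum of quotients. -/
lemma le_sInf_div {α : Type*} {S : Set α} {f g : α → ℝ} {m : ℝ} (hf : ∀ x ∈ S, 0 ≤ f x)
    (hne : ∃ x ∈ S, 0 < f x) (h : ∀ x ∈ S, m * f x ≤ g x) :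
    m ≤ sInf ((fun x => g x / f x) '' {x | x ∈ S ∧ f x ≠ 0}) := by
  obtain ⟨z, hz, hz0⟩ := hne
  refine le_csInf ⟨_, z, ⟨hz, hz0.ne'⟩, rfl⟩ ?_
  rintro _ ⟨x, ⟨hx, hx0⟩, rfl⟩
  exact (le_div_iff₀ ((hf x hx).lt_of_ne' hx0)).2 (h x hx)

/-- An infimum of nonnegative quotients, multiplied by a denominator, is at most the
numerator. -/
lemma sInf_div_mul_le {α : Type*} {S : Set α} {f g : α → ℝ} (hf : ∀ x ∈ S, 0 ≤ f x)
    (hg : ∀ x ∈ S, 0 ≤ g x) {x : α} (hx : x ∈ S) :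
    sInf ((fun x => g x / f x) '' {x | x ∈ S ∧ f x ≠ 0}) * f x ≤ g x := by
  rcases eq_or_ne (f x) 0 with h0 | h0
  · simpa [h0] using hg x hx
  · rw [← le_div_iff₀ ((hf x hx).lt_of_ne' h0)]
    refine csInf_le ⟨0, ?_⟩ ⟨x, ⟨hx, h0⟩, rfl⟩
    rintro _ ⟨y, ⟨hy, -⟩, rfl⟩
    exact div_nonneg (hg y hy) (hf y hy)

/-- A concave positively homogeneous function is superadditive. -/
lemma IsAntinormOn.add_le {d : ℕ} {K : Set (EuclideanSpace ℝ (Fin d))}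
    {f : EuclideanSpace ℝ (Fin d) → ℝ} (hf : IsAntinormOn K f)
    {x y : EuclideanSpace ℝ (Fin d)} (hx : x ∈ K) (hy : y ∈ K) :
    f x + f y ≤ f (x + y) := by
  obtain ⟨-, hh, hc, -⟩ := hf
  have h0 : (0 : ℝ) ≤ 1 / 2 := by norm_num
  have h := hc.2 hx hy h0 h0 (by norm_num)
  have hm := hc.1 hx hy h0 h0 (by norm_num)
  have h2 := hh _ hm 2 (by norm_num)
  rw [show (2 : ℝ) • ((1 / 2 : ℝ) • x + (1 / 2 : ℝ) • y) = x + y by module] at h2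
  simp only [smul_eq_mul] at h
  linarith

/-- A superadditive positively homogeneous function on the orthant is concave. -/
lemma concaveOn_pos_of_superadditive {d : ℕ} {f : EuclideanSpace ℝ (Fin d) → ℝ}
    (hh : ∀ x ∈ pos d, ∀ l : ℝ, 0 ≤ l → f (l • x) = l * f x)
    (hs : ∀ x ∈ pos d, ∀ y ∈ pos d, f x + f y ≤ f (x + y)) : ConcaveOn ℝ (pos d) f := by
  refine ⟨fun x hx y hy s t hs ht _ => pos_add (pos_smul hx hs) (pos_smul hy ht),
    fun x hx y hy s t hs' ht _ => ?_⟩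
  rw [smul_eq_mul, smul_eq_mul, ← hh x hx s hs', ← hh y hy t ht]
  exact hs _ (pos_smul hx hs') _ (pos_smul hy ht)

/-- An upper semicontinuous antinorm on a closed cone is the infimum of the linear functionals
that dominate it. -/
lemma IsAntinormOn.exists_dot_lt {d : ℕ} {K : Set (EuclideanSpace ℝ (Fin d))}
    {f : EuclideanSpace ℝ (Fin d) → ℝ} (hf : IsAntinormOn K f) (hK : IsClosed K)
    (hsm : ∀ x ∈ K, ∀ l : ℝ, 0 ≤ l → l • x ∈ K) (hc : UpperSemicontinuousOn f K)
    {p : EuclideanSpace ℝ (Fin d)} (hp : p ∈ K) {c : ℝ} (hpc : f p < c) :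
    ∃ v, (∀ x ∈ K, f x ≤ dot v x) ∧ dot v p < c := by
  obtain ⟨-, hh, hcv, -⟩ := hf
  have hlsc : LowerSemicontinuousOn (-f) K := fun x hx r hr => by
    filter_upwards [hc x hx (-r) (by simp only [Pi.neg_apply] at hr; linarith)] with z hz
    simp only [Pi.neg_apply]
    linarith
  obtain ⟨b, hpb, hbc⟩ := exists_between hpc
  obtain ⟨l, k, hlk, hlp⟩ := ConvexOn.exists_affine_le_of_lt (𝕜 := ℝ) (a := -b) hp
    (by simpa using hpb) hK hlsc hcv.neg
  have hle : ∀ x ∈ K, l x + k ≤ -f x := fun x hx => by simpa using hlk ⟨x, hx⟩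
  replace hlp : l p + k = -b := by simpa using hlp
  have hk : k ≤ 0 := by
    have h0 := hle _ (hsm p hp 0 le_rfl)
    rw [hh p hp 0 le_rfl] at h0
    simpa using h0
  obtain ⟨v, hv⟩ := exists_eq_dot (-l)
  refine ⟨v, fun x hx => ?_, ?_⟩
  · rw [← hv]
    by_contra! hlt
    simp only [neg_apply] at hlt
    have hd : 0 < f x + l x := by linarith
    have hr : 0 ≤ (1 - k) / (f x + l x) := div_nonneg (by linarith) hd.le
    have h := hle _ (hsm x hx _ hr)
    rw [hh x hx _ hr, map_smul, smul_eq_mul] at h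
    have := div_mul_cancel₀ (1 - k) hd.ne'
    linarith
  · rw [← hv]
    simp only [neg_apply]
    linarith

/-- The ray through `a` consists of the multiples of `a`, on which `⟨a, ·⟩` is the multiplier. -/
lemma eq_dot_smul {a x : EuclideanSpace ℝ (Fin 2)} (hn : a 0 ^ 2 + a 1 ^ 2 = 1)
    (h : a 0 * x 1 - a 1 * x 0 = 0) : x = dot a x • a := by
  ext i
  fin_cases i
  · simp only [Fin.zero_eta, PiLp.smul_apply, smul_eq_mul, dot_two]
    linear_combination (-x 0) * hn - a 1 * h
  · simp only [Fin.mk_one, PiLp.smul_apply, smul_eq_mul, dot_two]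
    linear_combination (-x 1) * hn + a 0 * h

/-- Two vectors on the same side of `a` satisfy `⟨a, x⟩⟨a, y⟩ ≤ ⟨x, y⟩`. -/
lemma dot_mul_dot_le {a x y : EuclideanSpace ℝ (Fin 2)} (hn : a 0 ^ 2 + a 1 ^ 2 = 1)
    (h : 0 ≤ (a 0 * x 1 - a 1 * x 0) * (a 0 * y 1 - a 1 * y 0)) :
    dot a x * dot a y ≤ dot x y := by
  have e : dot x y - dot a x * dot a y =
      (a 0 * x 1 - a 1 * x 0) * (a 0 * y 1 - a 1 * y 0) := by
    simp only [dot_two]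
    linear_combination (-(x 0 * y 0 + x 1 * y 1)) * hn
  linarith

/-- Superadditivity across a vector where `f` touches a linear functional that dominates it. -/
lemma add_le_of_touching {d : ℕ} {K : Set (EuclideanSpace ℝ (Fin d))}
    {f : EuclideanSpace ℝ (Fin d) → ℝ} {a x y : EuclideanSpace ℝ (Fin d)} {t : ℝ}
    (hsm : ∀ x ∈ K, ∀ l : ℝ, 0 ≤ l → l • x ∈ K)
    (hh : ∀ x ∈ K, ∀ l : ℝ, 0 ≤ l → f (l • x) = l * f x)
    (hs : ∀ x ∈ K, ∀ y ∈ K, f x + f y ≤ f (x + y)) (ht0 : 0 ≤ t) (ht1 : t ≤ 1)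
    (hx : x ∈ K) (hc : t • x + y ∈ K) (hfc : f (t • x + y) = dot a (t • x + y))
    (hfx : f x ≤ dot a x) (hfy : f y ≤ dot a y) : f x + f y ≤ f (x + y) := by
  have h := hs _ (hsm x hx (1 - t) (by linarith)) _ hc
  rw [hh x hx _ (by linarith), hfc, dot_add, dot_smul,
    show (1 - t) • x + (t • x + y) = x + y by module] at h
  nlinarith [mul_le_mul_of_nonneg_left hfx ht0]

/-- A continuous antinorm on `K1 a` dominated by `⟨a, ·⟩` is the infimum of the linear functionals
given by vectors of `K2 a` that dominate it. -/
lemma exists_mem_K2_dot_lt {a : EuclideanSpace ℝ (Fin 2)} (ha : a ∈ pos 2)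
    (hn : a 0 ^ 2 + a 1 ^ 2 = 1) {f₁ : EuclideanSpace ℝ (Fin 2) → ℝ}
    (hf₁ : IsAntinormOn (K1 a) f₁) (hc₁ : ContinuousOn f₁ (K1 a)) (hfa : f₁ a = 1)
    (hle : ∀ x ∈ K1 a, f₁ x ≤ dot a x) {p : EuclideanSpace ℝ (Fin 2)} (hp : p ∈ K1 a)
    {c : ℝ} (hpc : f₁ p < c) :
    ∃ v ∈ K2 a, (∀ z ∈ K1 a, f₁ z ≤ dot v z) ∧ dot v p < c := by
  have haK1 : a ∈ K1 a := ⟨ha, by linarith⟩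
  have haK2 : a ∈ K2 a := ⟨ha, by linarith⟩
  rcases (hle p hp).eq_or_lt with he | hlt
  · exact ⟨a, haK2, hle, he ▸ hpc⟩
  obtain ⟨v, hv, hvp⟩ := hf₁.exists_dot_lt (isClosed_K1 a) (fun x hx l hl => K1_smul hx hl)
    hc₁.upperSemicontinuousOn hp (lt_min hpc hlt)
  obtain ⟨hvc, hva⟩ := lt_min_iff.1 hvp
  refine ⟨v, ?_, hv, hvc⟩
  have ha0 : 0 ≤ a 0 := ha 0
  have ha1 : 0 ≤ a 1 := ha 1
  have hp0 : 0 ≤ p 0 := hp.1 0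
  have hD : 0 ≤ a 0 * p 1 - a 1 * p 0 := hp.2
  have hv1a : 1 ≤ v 0 * a 0 + v 1 * a 1 := by
    have := hv a haK1
    rwa [hfa, dot_two] at this
  have hv1 : 0 ≤ v 1 := by
    have he : !₂[(0 : ℝ), 1] ∈ K1 a := ⟨by simp [pos, Fin.forall_fin_two], by simpa using ha0⟩
    have := (hf₁.1 _ he).trans (hv _ he)
    simpa [dot_two] using this
  rw [dot_two, dot_two] at hva
  have ha0' : 0 < a 0 := by
    refine ha0.lt_of_ne' fun h => ?_
    have ha1' : a 1 = 1 := by nlinarith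
    have hp0' : p 0 = 0 := by rw [h, ha1'] at hD; linarith
    have hp1 : 0 ≤ p 1 := hp.1 1
    rw [h, ha1', hp0'] at hva
    rw [h, ha1'] at hv1a
    nlinarith
  have hv1lt : v 1 < a 1 := by
    have h1 : a 0 * (v 0 * p 0 + v 1 * p 1) < a 0 * (a 0 * p 0 + a 1 * p 1) :=
      mul_lt_mul_of_pos_left hva ha0'
    have h2 := mul_le_mul_of_nonneg_left hv1a hp0
    have h3 : (a 0 * p 1 - a 1 * p 0) * v 1 < (a 0 * p 1 - a 1 * p 0) * a 1 := by
      have h4 : p 0 * (a 0 ^ 2 + a 1 ^ 2) = p 0 := by rw [hn, mul_one]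
      nlinarith
    exact lt_of_mul_lt_mul_left h3 hD
  have hv0 : a 0 ≤ v 0 := by
    refine le_of_mul_le_mul_right ?_ ha0'
    nlinarith [mul_le_mul_of_nonneg_right hv1lt.le ha1]
  refine ⟨Fin.forall_fin_two.2 ⟨ha0.trans hv0, hv1⟩, ?_⟩
  nlinarith [mul_le_mul_of_nonneg_left hv1lt.le ha0, mul_le_mul_of_nonneg_left hv0 ha1]

/-- Construction of self-dual antinorms in the plane (sufficiency): given
`a ∈ ℝ²₊` with `|a| = 1`, a continuous antinorm `f₁` on `K₁` with `f₁(a) = 1` and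
`f₁ ≤ ⟨a,·⟩` on `K₁`, and `f₂` on `K₂` dual to `f₁`, the functions `f₁, f₂` agree
on `K₁ ∩ K₂`, and any `f` equal to `f₁` on `K₁` and to `f₂` on `K₂` is a
self-dual antinorm on `ℝ²₊`. -/
theorem construction_self_dual_antinorm_plane
    (a : EuclideanSpace ℝ (Fin 2)) (ha : a ∈ pos 2) (hna : ‖a‖ = 1)
    (f₁ : EuclideanSpace ℝ (Fin 2) → ℝ)
    (hf₁ : IsAntinormOn (K1 a) f₁) (hc₁ : ContinuousOn f₁ (K1 a))
    (hfa : f₁ a = 1) (hle : ∀ x ∈ K1 a, f₁ x ≤ dot a x)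
    (f₂ : EuclideanSpace ℝ (Fin 2) → ℝ)
    (hf₂ : ∀ y, f₂ y =
      sInf ((fun x => dot x y / f₁ x) '' {x | x ∈ K1 a ∧ f₁ x ≠ 0})) :
    (∀ x, x ∈ K1 a → x ∈ K2 a → f₁ x = f₂ x) ∧
    ∀ f : EuclideanSpace ℝ (Fin 2) → ℝ,
      (∀ x ∈ K1 a, f x = f₁ x) → (∀ x ∈ K2 a, f x = f₂ x) →
      IsAntinorm f ∧ ∀ p ∈ pos 2, dualAntinorm f p = f p := by
  obtain ⟨hf₁0, hf₁h, -, hf₁p⟩ := id hf₁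
  have hn : a 0 ^ 2 + a 1 ^ 2 = 1 := by
    have := EuclideanSpace.real_norm_sq_eq a
    rw [hna, Fin.sum_univ_two] at this
    linarith
  have haK1 : a ∈ K1 a := ⟨ha, by linarith⟩
  have le_f₂ : ∀ {y : EuclideanSpace ℝ (Fin 2)} {m : ℝ},
      (∀ x ∈ K1 a, m * f₁ x ≤ dot x y) → m ≤ f₂ y := fun h => by
    rw [hf₂]
    exact le_sInf_div hf₁0 hf₁p h
  have f₂_mul_le : ∀ y ∈ pos 2, ∀ x ∈ K1 a, f₂ y * f₁ x ≤ dot x y := fun y hy x hx => by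
    rw [hf₂]
    exact sInf_div_mul_le (g := fun x => dot x y) hf₁0 (fun z hz => dot_nonneg hz.1 hy) hx
  have f₂_le : ∀ y ∈ pos 2, f₂ y ≤ dot a y := fun y hy => by
    simpa [hfa] using f₂_mul_le y hy a haK1
  have f₂_nonneg : ∀ y ∈ pos 2, 0 ≤ f₂ y := fun y hy =>
    le_f₂ fun x hx => by simpa using dot_nonneg hx.1 hy
  have f₁_ray : ∀ x, x ∈ K1 a → x ∈ K2 a → f₁ x = dot a x := fun x h1 h2 => by
    have e := eq_dot_smul hn (le_antisymm h2.2 h1.2)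
    have := hf₁h a haK1 (dot a x) (dot_nonneg ha h1.1)
    rwa [← e, hfa, mul_one] at this
  have f₂_ray : ∀ x, x ∈ K1 a → x ∈ K2 a → f₂ x = dot a x := fun x h1 h2 => by
    refine le_antisymm (f₂_le x h1.1) (le_f₂ fun z hz => ?_)
    have e := eq_dot_smul hn (le_antisymm h2.2 h1.2)
    calc dot a x * f₁ z ≤ dot a x * dot a z :=
          mul_le_mul_of_nonneg_left (hle z hz) (dot_nonneg ha h1.1)
      _ = dot z (dot a x • a) := by rw [dot_smul, dot_comm a z]
      _ = dot z x := by rw [← e]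
  have f₂_add : ∀ x ∈ pos 2, ∀ y ∈ pos 2, f₂ x + f₂ y ≤ f₂ (x + y) := fun x hx y hy =>
    le_f₂ fun z hz => by
      rw [add_mul, dot_add]
      exact add_le_add (f₂_mul_le x hx z hz) (f₂_mul_le y hy z hz)
  have f₂_smul_le : ∀ x ∈ pos 2, ∀ l : ℝ, 0 ≤ l → l * f₂ x ≤ f₂ (l • x) := fun x hx l hl =>
    le_f₂ fun z hz => by
      rw [dot_smul, mul_assoc]
      exact mul_le_mul_of_nonneg_left (f₂_mul_le x hx z hz) hl
  have f₂_smul : ∀ x ∈ pos 2, ∀ l : ℝ, 0 ≤ l → f₂ (l • x) = l * f₂ x := fun x hx l hl => by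
    refine le_antisymm ?_ (f₂_smul_le x hx l hl)
    rcases hl.eq_or_lt with rfl | hl'
    · have h := f₂_le _ (pos_smul hx le_rfl)
      rw [dot_smul] at h
      linarith
    · have h := f₂_smul_le _ (pos_smul hx hl) l⁻¹ (inv_nonneg.2 hl)
      rwa [inv_smul_smul₀ hl'.ne', inv_mul_le_iff₀ hl'] at h
  refine ⟨fun x h1 h2 => (f₁_ray x h1 h2).trans (f₂_ray x h1 h2).symm, fun f hfK1 hfK2 => ?_⟩
  have hcases : ∀ x ∈ pos 2, x ∈ K1 a ∨ x ∈ K2 a := fun x hx =>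
    (le_total 0 (a 0 * x 1 - a 1 * x 0)).imp (fun h => ⟨hx, h⟩) (fun h => ⟨hx, h⟩)
  have f_nonneg : ∀ x ∈ pos 2, 0 ≤ f x := fun x hx => by
    rcases hcases x hx with h | h
    · exact hfK1 x h ▸ hf₁0 x h
    · exact hfK2 x h ▸ f₂_nonneg x hx
  have f_le : ∀ x ∈ pos 2, f x ≤ dot a x := fun x hx => by
    rcases hcases x hx with h | h
    · exact hfK1 x h ▸ hle x h
    · exact hfK2 x h ▸ f₂_le x hx
  have f_ray : ∀ x, x ∈ K1 a → x ∈ K2 a → f x = dot a x := fun x h1 h2 =>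
    (hfK1 x h1).trans (f₁_ray x h1 h2)
  have f_smul1 : ∀ x ∈ K1 a, ∀ l : ℝ, 0 ≤ l → f (l • x) = l * f x := fun x h l hl => by
    rw [hfK1 _ (K1_smul h hl), hfK1 x h, hf₁h x h l hl]
  have f_smul2 : ∀ x ∈ K2 a, ∀ l : ℝ, 0 ≤ l → f (l • x) = l * f x := fun x h l hl => by
    rw [hfK2 _ (K2_smul h hl), hfK2 x h, f₂_smul x h.1 l hl]
  have f_add1 : ∀ x ∈ K1 a, ∀ y ∈ K1 a, f x + f y ≤ f (x + y) := fun x hx y hy => by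
    have hxy : x + y ∈ K1 a := ⟨pos_add hx.1 hy.1, by
      have h1 := hx.2
      have h2 := hy.2
      simp only [PiLp.add_apply]
      linarith⟩
    rw [hfK1 x hx, hfK1 y hy, hfK1 _ hxy]
    exact hf₁.add_le hx hy
  have f_add2 : ∀ x ∈ K2 a, ∀ y ∈ K2 a, f x + f y ≤ f (x + y) := fun x hx y hy => by
    have hxy : x + y ∈ K2 a := ⟨pos_add hx.1 hy.1, by
      have h1 := hx.2
      have h2 := hy.2
      simp only [PiLp.add_apply]
      linarith⟩
    rw [hfK2 x hx, hfK2 y hy, hfK2 _ hxy]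
    exact f₂_add x hx.1 y hy.1
  have hray : ∀ x ∈ pos 2, ∀ y ∈ pos 2, ∀ t : ℝ, 0 ≤ t →
      t * (a 0 * x 1 - a 1 * x 0) + (a 0 * y 1 - a 1 * y 0) = 0 →
      t • x + y ∈ K1 a ∧ t • x + y ∈ K2 a := fun x hx y hy t ht h => by
    have hp := pos_add (pos_smul hx ht) hy
    have e : a 0 * (t • x + y) 1 - a 1 * (t • x + y) 0 = 0 := by
      simp only [PiLp.add_apply, PiLp.smul_apply, smul_eq_mul]
      linarith
    exact ⟨⟨hp, e.ge⟩, ⟨hp, e.le⟩⟩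
  have f_add12 : ∀ x ∈ K1 a, ∀ y ∈ K2 a, f x + f y ≤ f (x + y) := fun x hx y hy => by
    have h1 := hx.2
    have h2 := hy.2
    rcases hcases _ (pos_add hx.1 hy.1) with h | h
    · have h3 := h.2
      simp only [PiLp.add_apply] at h3
      have ht0 : 0 ≤ -(a 0 * y 1 - a 1 * y 0) / (a 0 * x 1 - a 1 * x 0) :=
        div_nonneg (by linarith) h1
      obtain ⟨c1, c2⟩ := hray x hx.1 y hy.1 _ ht0 (by
        rw [div_mul_cancel_of_imp (fun h0 => by linarith)]
        ring)
      exact add_le_of_touching (fun x hx l hl => K1_smul hx hl) f_smul1 f_add1 ht0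
        (div_le_one_of_le₀ (by linarith) h1) hx c1 (f_ray _ c1 c2) (f_le x hx.1) (f_le y hy.1)
    · have h3 := h.2
      simp only [PiLp.add_apply] at h3
      have ht0 : 0 ≤ (a 0 * x 1 - a 1 * x 0) / -(a 0 * y 1 - a 1 * y 0) :=
        div_nonneg h1 (by linarith)
      obtain ⟨c1, c2⟩ := hray y hy.1 x hx.1 _ ht0 (by
        rw [← neg_eq_zero, neg_add, ← mul_neg, div_mul_cancel_of_imp (fun h0 => by linarith)]
        ring)
      rw [add_comm (f x), add_comm x]
      exact add_le_of_touching (fun x hx l hl => K2_smul hx hl) f_smul2 f_add2 ht0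
        (div_le_one_of_le₀ (by linarith) (by linarith)) hy c2 (f_ray _ c1 c2)
        (f_le y hy.1) (f_le x hx.1)
  have f_smul : ∀ x ∈ pos 2, ∀ l : ℝ, 0 ≤ l → f (l • x) = l * f x := fun x hx =>
    (hcases x hx).elim (f_smul1 x) (f_smul2 x)
  have f_add : ∀ x ∈ pos 2, ∀ y ∈ pos 2, f x + f y ≤ f (x + y) := fun x hx y hy => by
    rcases hcases x hx with h | h <;> rcases hcases y hy with h' | h'
    · exact f_add1 x h y h'
    · exact f_add12 x h y h'
    · rw [add_comm (f x), add_comm x]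
      exact f_add12 y h' x h
    · exact f_add2 x h y h'
  have f_pos : ∃ x ∈ pos 2, 0 < f x := ⟨a, ha, by rw [hfK1 a haK1, hfa]; exact one_pos⟩
  have f_mul_same : ∀ x ∈ pos 2, ∀ y ∈ pos 2,
      0 ≤ (a 0 * x 1 - a 1 * x 0) * (a 0 * y 1 - a 1 * y 0) → f x * f y ≤ dot x y :=
    fun x hx y hy h =>
      (mul_le_mul (f_le x hx) (f_le y hy) (f_nonneg y hy) (dot_nonneg ha hx)).trans
        (dot_mul_dot_le hn h)
  have f_mul : ∀ x ∈ pos 2, ∀ y ∈ pos 2, f x * f y ≤ dot x y := fun x hx y hy => by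
    rcases hcases x hx with h | h <;> rcases hcases y hy with h' | h'
    · exact f_mul_same x hx y hy (mul_nonneg h.2 h'.2)
    · rw [hfK1 x h, hfK2 y h', mul_comm]
      exact f₂_mul_le y hy x h
    · rw [hfK2 x h, hfK1 y h', dot_comm]
      exact f₂_mul_le x hx y h'
    · exact f_mul_same x hx y hy (mul_nonneg_of_nonpos_of_nonpos h.2 h'.2)
  refine ⟨⟨f_nonneg, f_smul, concaveOn_pos_of_superadditive f_smul f_add, f_pos⟩,
    fun p hp => le_antisymm ?_ (le_sInf_div f_nonneg f_pos fun x hx => f_mul p hp x hx)⟩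
  have hdual : ∀ x ∈ pos 2, dualAntinorm f p * f x ≤ dot p x := fun x hx =>
    sInf_div_mul_le f_nonneg (fun z hz => dot_nonneg hp hz) hx
  rcases hcases p hp with h | h
  · by_contra! hlt
    rw [hfK1 p h] at hlt
    obtain ⟨v, hv2, hv, hvp⟩ := exists_mem_K2_dot_lt ha hn hf₁ hc₁ hfa hle h hlt
    have h1 : 1 ≤ f v := by
      rw [hfK2 v hv2]
      exact le_f₂ fun z hz => by rw [one_mul, dot_comm]; exact hv z hz
    have h2 := hdual v hv2.1
    rw [dot_comm] at h2
    nlinarith [hf₁0 p h]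
  · rw [hfK2 p h]
    exact le_f₂ fun x hx => by
      rw [dot_comm, ← hfK1 x hx]
      exact hdual x hx.1
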